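/- arXiv:1112.5042 — 8 statements merged into one kernel-verified Lean document; each statement's English description precedes it below -/
import Mathlib

section
/- Strauss estimate: for every continuously differentiable function ψ : [1,∞) → ℝ that vanishes outside a compact set and every r ≥ 1, one has |ψ(r)| ≤ 2 r^{-1/2} (∫₁^∞ ψ'(s)² s² ds)^{1/2}. -/
open MeasureTheory Set

/-- The weighted energy density of a compactly supported `C¹` function is integrable. -/
theorem integrableOn_sq_deriv_mul_sq
    {ψ ψ' : ℝ → ℝ} {R : ℝ} (hR : 1 < R)
    (hderiv : ∀ r ∈ Ici (1:ℝ), HasDerivWithinAt ψ (ψ' r) (Ici 1) r)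
    (hcont : ContinuousOn ψ' (Ici 1)) (hsupp : ∀ r ≥ R, ψ r = 0) :
    IntegrableOn (fun s => (ψ' s) ^ 2 * s ^ 2) (Ioi (1:ℝ)) := by
  have hzero : ∀ s ∈ Ioi R, ψ' s = 0 := fun s hs => by
    have h1 : HasDerivAt ψ (ψ' s) s :=
      (hderiv s (hR.trans hs).le).hasDerivAt (Ici_mem_nhds (hR.trans hs))
    have h2 : ψ =ᶠ[nhds s] fun _ => 0 := by
      filter_upwards [Ioi_mem_nhds hs] with x hx using hsupp x (le_of_lt hx)
    exact h1.unique ((hasDerivAt_const s (0:ℝ)).congr_of_eventuallyEq h2)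
  rw [← Ioc_union_Ioi_eq_Ioi hR.le]
  refine IntegrableOn.union ?_ ?_
  · have hc : ContinuousOn (fun s => (ψ' s) ^ 2 * s ^ 2) (Icc 1 R) :=
      ((hcont.mono Icc_subset_Ici_self).pow 2).mul (continuousOn_id.pow 2)
    exact hc.integrableOn_Icc.mono_set Ioc_subset_Icc_self
  · refine integrableOn_zero.congr_fun (fun s hs => ?_) measurableSet_Ioi
    simp [hzero s hs]

/-- The strong form of the Strauss estimate, with constant `1`. -/
theorem sq_le_inv_mul_integral_sq_deriv_mul_sq
    {ψ ψ' : ℝ → ℝ} {R : ℝ} (hR : 1 < R)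
    (hderiv : ∀ r ∈ Ici (1:ℝ), HasDerivWithinAt ψ (ψ' r) (Ici 1) r)
    (hcont : ContinuousOn ψ' (Ici 1)) (hsupp : ∀ r ≥ R, ψ r = 0) {r : ℝ} (hr : 1 ≤ r) :
    (ψ r) ^ 2 ≤ r⁻¹ * ∫ s in Ioi (1:ℝ), (ψ' s) ^ 2 * s ^ 2 := by
  set A := ∫ s in Ioi (1:ℝ), (ψ' s) ^ 2 * s ^ 2
  set T := max R r
  have hrT : r ≤ T := le_max_right _ _
  have hT : 0 < T := by linarith
  have hsub : Icc r T ⊆ Ici 1 := fun s hs => hr.trans hs.1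
  have hne : ∀ s ∈ Icc r T, s ≠ 0 := fun s hs => by
    have := hs.1
    intro h
    linarith
  have hcψ' : ContinuousOn ψ' (Icc r T) := hcont.mono hsub
  have hcψ : ContinuousOn ψ (Icc r T) :=
    fun s hs => (hderiv s (hsub hs)).continuousWithinAt.mono hsub
  have hcinv : ContinuousOn (fun s : ℝ => s⁻¹) (Icc r T) := continuousOn_id.inv₀ hne
  have hA_ge : ∫ s in r..T, (ψ' s) ^ 2 * s ^ 2 ≤ A := by
    rw [intervalIntegral.integral_of_le hrT]
    refine setIntegral_mono_set (integrableOn_sq_deriv_mul_sq hR hderiv hcont hsupp)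
      (Filter.Eventually.of_forall fun s => ?_) (LE.le.eventuallyLE ?_)
    · show (0:ℝ) ≤ _
      positivity
    · exact fun s hs => lt_of_le_of_lt hr hs.1
  -- nonnegativity of the integral of `(t ψ' s - 1 / s) ^ 2` for every `t`
  have hquad : ∀ t : ℝ, 0 ≤ A * (t * t) + (2 * ψ r) * t + r⁻¹ := fun t => by
    have hcE : ContinuousOn (fun s => t ^ 2 * ((ψ' s) ^ 2 * s ^ 2)) (Icc r T) :=
      continuousOn_const.mul ((hcψ'.pow 2).mul (continuousOn_id.pow 2))
    have hcG : ContinuousOn (fun s => -2 * t * ψ' s + (s⁻¹) ^ 2) (Icc r T) :=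
      (continuousOn_const.mul hcψ').add (hcinv.pow 2)
    have hiE := hcE.intervalIntegrable_of_Icc (μ := volume) hrT
    have hiG := hcG.intervalIntegrable_of_Icc (μ := volume) hrT
    have hG : ∫ s in r..T, (-2 * t * ψ' s + (s⁻¹) ^ 2)
        = (-2 * t * ψ T - T⁻¹) - (-2 * t * ψ r - r⁻¹) := by
      refine intervalIntegral.integral_eq_sub_of_hasDerivAt_of_le hrT
        (f := fun s => -2 * t * ψ s - s⁻¹)
        ((continuousOn_const.mul hcψ).sub hcinv) (fun s hs => ?_) hiG
      have hs1 : 1 < s := lt_of_le_of_lt hr hs.1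
      have h1 : HasDerivAt ψ (ψ' s) s := (hderiv s hs1.le).hasDerivAt (Ici_mem_nhds hs1)
      refine ((h1.const_mul (-2 * t)).sub
        (hasDerivAt_inv (hne s (Ioo_subset_Icc_self hs)))).congr_deriv ?_
      rw [inv_pow]
      ring
    have hnonneg : 0 ≤ ∫ s in r..T,
        (t ^ 2 * ((ψ' s) ^ 2 * s ^ 2) + (-2 * t * ψ' s + (s⁻¹) ^ 2)) := by
      refine intervalIntegral.integral_nonneg hrT fun s hs => ?_
      have h : t ^ 2 * ((ψ' s) ^ 2 * s ^ 2) + (-2 * t * ψ' s + (s⁻¹) ^ 2)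
          = (t * ψ' s * s - s⁻¹) ^ 2 := by
        have := hne s hs
        field_simp
        ring
      rw [h]
      positivity
    rw [intervalIntegral.integral_add hiE hiG, hG, intervalIntegral.integral_const_mul,
      hsupp T (le_max_left _ _)] at hnonneg
    have := mul_le_mul_of_nonneg_left hA_ge (sq_nonneg t)
    have := inv_pos.mpr hT
    nlinarith
  have := discrim_le_zero hquad
  rw [discrim] at this
  nlinarith

/-- Strauss estimate: for every `C¹` function `ψ : [1,∞) → ℝ` vanishing outside a
compact set and every `r ≥ 1`, `|ψ(r)| ≤ 2 r^{-1/2} (∫₁^∞ ψ'(s)² s² ds)^{1/2}`. -/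
theorem strauss_estimate
    (ψ ψ' : ℝ → ℝ)
    (hderiv : ∀ r ∈ Ici (1:ℝ), HasDerivWithinAt ψ (ψ' r) (Ici 1) r)
    (hcont : ContinuousOn ψ' (Ici 1))
    (hsupp : ∃ R > (1:ℝ), ∀ r ≥ R, ψ r = 0) :
    ∀ r ≥ (1:ℝ),
      |ψ r| ≤ 2 * r ^ (-(1/2) : ℝ) * Real.sqrt (∫ s in Ioi (1:ℝ), (ψ' s) ^ 2 * s ^ 2) := by
  obtain ⟨R, hR, hsupp⟩ := hsupp
  intro r hr
  have hr0 : 0 ≤ r := by linarith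
  have h := Real.abs_le_sqrt
    (sq_le_inv_mul_integral_sq_deriv_mul_sq hR hderiv hcont hsupp hr)
  rw [Real.sqrt_mul (inv_nonneg.mpr hr0), Real.sqrt_inv, Real.sqrt_eq_rpow r,
    ← Real.rpow_neg hr0] at h
  have : 0 ≤ r ^ (-(1/2) : ℝ) * Real.sqrt (∫ s in Ioi (1:ℝ), (ψ' s) ^ 2 * s ^ 2) := by
    positivity
  linarith
end

section
/- Global coercivity of the virial functional: for every pair of functions (ψ, ψ̇) with ψ : [1,∞) → ℝ continuously differentiable, ψ(1) = 0, both ψ and ψ̇ vanishing outside a compact set and ψ̇ continuous, one has −∫₁^∞ ( (1/20) ψ̇(r)² + (19/20) ψ'(r)² ) r² dr + ∫₁^∞ ( sin²(ψ(r)) − (29/20) ψ(r) sin(2ψ(r)) ) dr ≤ −(1/20) ∫₁^∞ ( ψ̇(r)² + ψ'(r)² ) r² dr. -/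
open MeasureTheory Set

/-- A function vanishing at `0` with nonnegative derivative on `[0, ∞)` is nonnegative there. -/
lemma nonneg_of_hasDerivAt_nonneg {f f' : ℝ → ℝ} (h0 : f 0 = 0)
    (hf : ∀ x, HasDerivAt f (f' x) x) (hf' : ∀ x, 0 ≤ x → 0 ≤ f' x) {x : ℝ} (hx : 0 ≤ x) :
    0 ≤ f x := by
  have hmono : MonotoneOn f (Ici 0) := by
    refine monotoneOn_of_deriv_nonneg (convex_Ici 0)
      (fun y _ => (hf y).continuousAt.continuousWithinAt)
      (fun y _ => (hf y).differentiableAt.differentiableWithinAt) fun y hy => ?_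
    rw [interior_Ici] at hy
    rw [(hf y).deriv]
    exact hf' y (le_of_lt hy)
  simpa [h0] using hmono (mem_Ici.2 le_rfl) (mem_Ici.2 hx) hx

/-- If the `n`-th Taylor polynomial of `cos` at `0` lies on one side of `cos` on `[0, ∞)`,
then that of `sin` lies on the same side of `sin`. -/
lemma sin_taylor_of_cos_taylor {n : ℕ}
    (h : ∀ x : ℝ, 0 ≤ x → 0 ≤ (-1) ^ n * (Real.cos x -
      ∑ k ∈ Finset.range n, (-1) ^ k * x ^ (2 * k) / (2 * k).factorial))
    {x : ℝ} (hx : 0 ≤ x) :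
    0 ≤ (-1) ^ n * (Real.sin x -
      ∑ k ∈ Finset.range n, (-1) ^ k * x ^ (2 * k + 1) / (2 * k + 1).factorial) := by
  refine nonneg_of_hasDerivAt_nonneg (f := fun x => (-1) ^ n * (Real.sin x -
      ∑ k ∈ Finset.range n, (-1) ^ k * x ^ (2 * k + 1) / (2 * k + 1).factorial))
    (by simp) (fun y => ?_) h hx
  refine HasDerivAt.const_mul _ ((Real.hasDerivAt_sin y).sub (HasDerivAt.fun_sum fun k _ => ?_))
  refine (((hasDerivAt_pow (2 * k + 1) y).const_mul ((-1 : ℝ) ^ k)).div_const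
    ((2 * k + 1).factorial : ℝ)).congr_deriv ?_
  rw [Nat.factorial_succ]
  have := Nat.factorial_pos (2 * k)
  push_cast
  field_simp

/-- On `[0, ∞)` the Taylor polynomials of `cos` at `0` lie alternately above and below `cos`. -/
lemma cos_taylor (n : ℕ) : ∀ x : ℝ, 0 ≤ x → 0 ≤ (-1) ^ (n + 1) * (Real.cos x -
    ∑ k ∈ Finset.range (n + 1), (-1) ^ k * x ^ (2 * k) / (2 * k).factorial) := by
  induction n with
  | zero => intro x _; simpa using Real.cos_le_one x
  | succ n ih =>
    intro x hx
    refine nonneg_of_hasDerivAt_nonneg (f := fun x => (-1) ^ (n + 1 + 1) * (Real.cos x -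
        ∑ k ∈ Finset.range (n + 1 + 1), (-1) ^ k * x ^ (2 * k) / (2 * k).factorial))
      ?_ (fun y => ?_) (fun y hy => sin_taylor_of_cos_taylor ih hy) hx
    · simp [Finset.sum_range_succ']
    · simp only [Finset.sum_range_succ' _ (n + 1), mul_zero, pow_zero, Nat.factorial_zero,
        Nat.cast_one, div_one, mul_one]
      have hsum : HasDerivAt (fun x : ℝ => ∑ k ∈ Finset.range (n + 1),
          (-1) ^ (k + 1) * x ^ (2 * (k + 1)) / ((2 * (k + 1)).factorial : ℝ))
          (∑ k ∈ Finset.range (n + 1),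
            -((-1) ^ k * y ^ (2 * k + 1) / ((2 * k + 1).factorial : ℝ))) y := by
        refine HasDerivAt.fun_sum fun k _ => ?_
        refine (((hasDerivAt_pow (2 * (k + 1)) y).const_mul ((-1 : ℝ) ^ (k + 1))).div_const
          ((2 * (k + 1)).factorial : ℝ)).congr_deriv ?_
        rw [show 2 * (k + 1) = 2 * k + 1 + 1 by ring, Nat.factorial_succ]
        have := Nat.factorial_pos (2 * k + 1)
        push_cast
        field_simp
        ring
      refine (((Real.hasDerivAt_cos y).sub (hsum.add_const 1)).const_mul
        ((-1 : ℝ) ^ (n + 1 + 1))).congr_deriv ?_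
      rw [Finset.sum_neg_distrib]
      ring

/-- The weight `W` such that `r ↦ r * W (ψ r ^ 2)` is the corrector in the virial estimate. -/
noncomputable def virialWeight (s : ℝ) : ℝ :=
  1 / 4 * s + 155 / 48 * (1 - max 0 (1 - 4 / 25 * s) ^ 3)

/-- The derivative of `virialWeight`. -/
noncomputable def virialWeightDeriv (s : ℝ) : ℝ :=
  1 / 4 + 31 / 20 * max 0 (1 - 4 / 25 * s) ^ 2

lemma virialWeight_zero : virialWeight 0 = 0 := by simp [virialWeight]

lemma continuous_virialWeight : Continuous virialWeight := by
  unfold virialWeight; fun_prop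

lemma continuous_virialWeightDeriv : Continuous virialWeightDeriv := by
  unfold virialWeightDeriv; fun_prop

lemma hasDerivAt_max_zero_pow_three (x : ℝ) :
    HasDerivAt (fun x : ℝ => max 0 x ^ 3) (3 * max 0 x ^ 2) x := by
  have h := ((hasDerivAt_pow 3 x).add (hasDerivAt_abs_rpow x (p := 3) (by norm_num))).div_const 2
  have hmax : ∀ y : ℝ, max 0 y = (y + |y|) / 2 := fun y => by
    rw [max_def]; split_ifs with hy
    · rw [abs_of_nonneg hy]; ring
    · rw [abs_of_neg (not_le.1 hy)]; ring
  have hfun : (fun x : ℝ => max 0 x ^ 3) =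
      fun x => ((fun x : ℝ => x ^ 3) + fun x : ℝ => |x| ^ (3 : ℝ) : ℝ → ℝ) x / 2 := by
    ext y
    have h3 : |y| ^ (3 : ℝ) = |y| ^ 3 := by exact_mod_cast Real.rpow_natCast |y| 3
    simp only [Pi.add_apply]
    rw [h3, hmax]
    linear_combination (3 / 8 * y - 3 / 8 * |y|) * (sq_abs y)
  rw [hfun]
  refine h.congr_deriv ?_
  rw [hmax, show (3 : ℝ) - 2 = 1 by norm_num, Real.rpow_one]
  push_cast
  linear_combination (-3 / 4) * (sq_abs x)

lemma hasDerivAt_virialWeight (s : ℝ) :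
    HasDerivAt virialWeight (virialWeightDeriv s) s := by
  have hlin : HasDerivAt (fun s : ℝ => 1 - 4 / 25 * s) (-(4 / 25 * 1)) s :=
    ((hasDerivAt_id s).const_mul (4 / 25 : ℝ)).const_sub 1
  have h := ((hasDerivAt_id s).const_mul (1 / 4 : ℝ)).add
    ((((hasDerivAt_max_zero_pow_three _).comp s hlin).const_sub 1).const_mul (155 / 48 : ℝ))
  refine h.congr_deriv ?_
  unfold virialWeightDeriv
  ring

/-- The pointwise bound for small arguments, from the Taylor bounds of `sin` and `cos`. -/
lemma virial_potential_le_of_le {x : ℝ} (hx : 0 ≤ x) (hx' : x ≤ 5 / 2) :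
    Real.sin x ^ 2 - (29 / 20) * x * Real.sin (2 * x) ≤
      virialWeight (x ^ 2) - 10 / 9 * x ^ 2 * virialWeightDeriv (x ^ 2) ^ 2 := by
  have hcos := cos_taylor 7 (2 * x) (by positivity)
  have hsin := sin_taylor_of_cos_taylor (cos_taylor 7) (x := 2 * x) (by positivity)
  have hxsin := mul_nonneg hx hsin
  have hsq : Real.sin x ^ 2 = 1 / 2 - Real.cos (2 * x) / 2 := Real.sin_sq_eq_half_sub x
  have hs : x ^ 2 ≤ 25 / 4 := by nlinarith
  unfold virialWeight virialWeightDeriv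
  rw [hsq, max_eq_right (by linarith)]
  simp only [Finset.sum_range_succ, Finset.sum_range_zero, Nat.factorial] at hcos hxsin
  norm_num at hcos hxsin
  rcases le_total (x ^ 2) 3 with h | h
  · have hbern : ∀ i j : ℕ, 0 ≤ x ^ 2 * ((x ^ 2) ^ i * (3 - x ^ 2) ^ j) := fun i j =>
      mul_nonneg (sq_nonneg x) (mul_nonneg (by positivity) (pow_nonneg (by linarith) j))
    linarith [hbern 0 7, hbern 1 6, hbern 2 5, hbern 3 4, hbern 4 3, hbern 5 2, hbern 6 1,
      hbern 7 0]
  · have hbern : ∀ i j : ℕ, 0 ≤ x ^ 2 * ((x ^ 2 - 3) ^ i * (25 / 4 - x ^ 2) ^ j) := fun i j =>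
      mul_nonneg (sq_nonneg x)
        (mul_nonneg (pow_nonneg (by linarith) i) (pow_nonneg (by linarith) j))
    linarith [hbern 0 7, hbern 1 6, hbern 2 5, hbern 3 4, hbern 4 3, hbern 5 2, hbern 6 1,
      hbern 7 0]

lemma virial_potential_le_of_ge {x : ℝ} (hx : 5 / 2 ≤ x) :
    Real.sin x ^ 2 - (29 / 20) * x * Real.sin (2 * x) ≤
      virialWeight (x ^ 2) - 10 / 9 * x ^ 2 * virialWeightDeriv (x ^ 2) ^ 2 := by
  have hsq : Real.sin x ^ 2 = 1 / 2 - Real.cos (2 * x) / 2 := Real.sin_sq_eq_half_sub x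
  have hs : 25 / 4 ≤ x ^ 2 := by nlinarith
  unfold virialWeight virialWeightDeriv
  rw [hsq, max_eq_left (by linarith)]
  have hcs := Real.sin_sq_add_cos_sq (2 * x)
  have hpi := Real.pi_gt_d2
  have hpi' := Real.pi_lt_d2
  by_cases hmid : 29 / 10 ≤ x ∧ x ≤ 513 / 100
  · have hsin : -(21 / 25) ≤ Real.sin (2 * x) := by
      rcases le_total (2 * x) (2 * Real.pi) with h | h
      · have h1 := Real.sin_le (x := 2 * Real.pi - 2 * x) (by linarith)
        rw [Real.sin_two_pi_sub] at h1
        linarith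
      rcases le_total (2 * x) (3 * Real.pi) with h' | h'
      · have h1 := Real.sin_nonneg_of_nonneg_of_le_pi (x := 2 * x - 2 * Real.pi) (by linarith)
          (by linarith)
        rw [Real.sin_sub_two_pi] at h1
        linarith
      · have h1 := Real.sin_le (x := 2 * x - 2 * Real.pi - Real.pi) (by linarith)
        rw [Real.sin_sub_pi, Real.sin_sub_two_pi] at h1
        linarith
    have hcos := Real.neg_one_le_cos (2 * x)
    nlinarith [mul_le_mul_of_nonneg_left hsin (by linarith : 0 ≤ x), sq_nonneg (x - 3.2)]
  · have hA : -(Real.cos (2 * x) / 2) - 29 / 20 * x * Real.sin (2 * x) ≤ 29 / 20 * x + 35 / 1000 := by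
      refine abs_le_of_sq_le_sq' ?_ (by positivity) |>.2
      nlinarith [sq_nonneg (Real.sin (2 * x) / 2 - 29 / 20 * x * Real.cos (2 * x))]
    rcases not_and_or.1 hmid with h | h
    · nlinarith [mul_pos (sub_pos.2 (not_le.1 h)) (sub_pos.2 (not_le.1 h))]
    · nlinarith [mul_pos (sub_pos.2 (not_le.1 h)) (sub_pos.2 (not_le.1 h))]

lemma virial_potential_le (x : ℝ) :
    Real.sin x ^ 2 - (29 / 20) * x * Real.sin (2 * x) ≤
      virialWeight (x ^ 2) - 10 / 9 * x ^ 2 * virialWeightDeriv (x ^ 2) ^ 2 := by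
  have hnonneg : ∀ y : ℝ, 0 ≤ y → Real.sin y ^ 2 - (29 / 20) * y * Real.sin (2 * y) ≤
      virialWeight (y ^ 2) - 10 / 9 * y ^ 2 * virialWeightDeriv (y ^ 2) ^ 2 := fun y hy =>
    (le_total y (5 / 2)).elim (virial_potential_le_of_le hy) virial_potential_le_of_ge
  rcases le_total 0 x with hx | hx
  · exact hnonneg x hx
  · have h := hnonneg (-x) (by linarith)
    simpa [mul_neg] using h

lemma virial_potential_le_deriv_add (x p r : ℝ) :
    Real.sin x ^ 2 - (29 / 20) * x * Real.sin (2 * x) ≤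
      (virialWeight (x ^ 2) + r * (virialWeightDeriv (x ^ 2) * (2 * x * p)))
        + 9 / 10 * (p ^ 2 * r ^ 2) := by
  nlinarith [virial_potential_le x, sq_nonneg (9 * (r * p) + 10 * x * virialWeightDeriv (x ^ 2))]

/-- Global coercivity of the virial functional `𝓛` on the energy space. -/
theorem virial_functional_coercive
    (ψ ψ' ψdot : ℝ → ℝ)
    (hderiv : ∀ r ∈ Ici (1:ℝ), HasDerivWithinAt ψ (ψ' r) (Ici 1) r)
    (hcont : ContinuousOn ψ' (Ici 1))
    (hbc : ψ 1 = 0)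
    (hsupp : ∃ R > (1:ℝ), ∀ r ≥ R, ψ r = 0)
    (hdotcont : ContinuousOn ψdot (Ici 1))
    (hdotsupp : ∃ R > (1:ℝ), ∀ r ≥ R, ψdot r = 0) :
    -(∫ r in Ioi (1:ℝ), ((1/20) * (ψdot r) ^ 2 + (19/20) * (ψ' r) ^ 2) * r ^ 2)
      + (∫ r in Ioi (1:ℝ),
          (Real.sin (ψ r) ^ 2 - (29/20) * ψ r * Real.sin (2 * ψ r)))
    ≤ -(1/20) * ∫ r in Ioi (1:ℝ), ((ψdot r) ^ 2 + (ψ' r) ^ 2) * r ^ 2 := by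
  obtain ⟨R₁, hR₁, h₁⟩ := hsupp
  obtain ⟨R₂, hR₂, h₂⟩ := hdotsupp
  set R := max R₁ R₂
  have hR : 1 ≤ R := hR₁.le.trans (le_max_left _ _)
  have hψ : ∀ r, R ≤ r → ψ r = 0 := fun r hr => h₁ r ((le_max_left _ _).trans hr)
  have hψdot : ∀ r, R ≤ r → ψdot r = 0 := fun r hr => h₂ r ((le_max_right _ _).trans hr)
  have hψ' : ∀ r, R < r → ψ' r = 0 := fun r hr => by
    have hr1 : 1 < r := hR.trans_lt hr
    have hd := (hderiv r hr1.le).hasDerivAt (Ici_mem_nhds hr1)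
    refine hd.unique ((hasDerivAt_const r (0 : ℝ)).congr_of_eventuallyEq ?_)
    filter_upwards [Ioi_mem_nhds hr] with y hy using hψ y (le_of_lt hy)
  have hrestrict : ∀ f : ℝ → ℝ, (∀ r, R < r → f r = 0) →
      ∫ r in Ioi (1:ℝ), f r = ∫ r in (1:ℝ)..R, f r := fun f hf => by
    rw [intervalIntegral.integral_of_le hR]
    refine (setIntegral_eq_of_subset_of_forall_sdiff_eq_zero measurableSet_Ioi
      Ioc_subset_Ioi_self fun r hr => hf r ?_)
    by_contra h
    exact hr.2 ⟨hr.1, not_lt.1 h⟩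
  have hInterval : ∀ f : ℝ → ℝ, ContinuousOn f (Ici 1) → IntervalIntegrable f volume 1 R :=
    fun f hf => (hf.mono (by rw [uIcc_of_le hR]; exact Icc_subset_Ici_self)).intervalIntegrable
  have hψc : ContinuousOn ψ (Ici 1) := fun r hr => (hderiv r hr).continuousWithinAt
  have hWc := continuous_virialWeight.comp_continuousOn (hψc.pow 2)
  have hWdc := continuous_virialWeightDeriv.comp_continuousOn (hψc.pow 2)
  have hdE : ∀ r ∈ Ici (1:ℝ), HasDerivWithinAt (fun r => r * virialWeight (ψ r ^ 2))
      (virialWeight (ψ r ^ 2) + r * (virialWeightDeriv (ψ r ^ 2) * (2 * ψ r * ψ' r)))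
      (Ici 1) r := fun r hr => by
    have h := (hasDerivWithinAt_id r (Ici 1)).mul
      ((hasDerivAt_virialWeight (ψ r ^ 2)).comp_hasDerivWithinAt r ((hderiv r hr).pow 2))
    exact h.congr_deriv (by simp)
  have hEc : ContinuousOn (fun r => virialWeight (ψ r ^ 2)
      + r * (virialWeightDeriv (ψ r ^ 2) * (2 * ψ r * ψ' r))) (Ici 1) :=
    hWc.add (continuousOn_id.mul (hWdc.mul ((continuousOn_const.mul hψc).mul hcont)))
  have hE : ∫ r in (1:ℝ)..R, (virialWeight (ψ r ^ 2)
      + r * (virialWeightDeriv (ψ r ^ 2) * (2 * ψ r * ψ' r))) = 0 := by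
    rw [intervalIntegral.integral_eq_sub_of_hasDeriv_right_of_le hR
      (fun r hr => ((hdE r hr.1).continuousWithinAt).mono Icc_subset_Ici_self)
      (fun r hr => (hdE r hr.1.le).mono (Ioi_subset_Ici hr.1.le)) (hInterval _ hEc)]
    simp [hψ R le_rfl, hbc, virialWeight_zero]
  have hPc : ContinuousOn (fun r => Real.sin (ψ r) ^ 2
      - (29/20) * ψ r * Real.sin (2 * ψ r)) (Ici 1) := by fun_prop
  have hKc : ContinuousOn (fun r => ψ' r ^ 2 * r ^ 2) (Ici 1) := by fun_prop
  have hDc : ContinuousOn (fun r => ψdot r ^ 2 * r ^ 2) (Ici 1) := by fun_prop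
  have hmain := intervalIntegral.integral_mono_on hR (hInterval _ hPc)
    ((hInterval _ hEc).add ((hInterval _ hKc).const_mul (9 / 10)))
    fun r _ => virial_potential_le_deriv_add (ψ r) (ψ' r) r
  rw [intervalIntegral.integral_add (hInterval _ hEc) ((hInterval _ hKc).const_mul (9 / 10)), hE,
    intervalIntegral.integral_const_mul] at hmain
  have hsplit : ∀ a b : ℝ, ∫ r in (1:ℝ)..R, (a * ψdot r ^ 2 + b * ψ' r ^ 2) * r ^ 2 =
      a * (∫ r in (1:ℝ)..R, ψdot r ^ 2 * r ^ 2) + b * ∫ r in (1:ℝ)..R, ψ' r ^ 2 * r ^ 2 :=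
    fun a b => by
      rw [← intervalIntegral.integral_const_mul, ← intervalIntegral.integral_const_mul,
        ← intervalIntegral.integral_add ((hInterval _ hDc).const_mul a) ((hInterval _ hKc).const_mul b)]
      congr 1
      ext r
      ring
  have hone := hsplit 1 1
  simp only [one_mul] at hone
  rw [hrestrict _ fun r hr => by simp [hψ' r hr, hψdot r hr.le],
    hrestrict _ fun r hr => by simp [hψ r hr.le],
    hrestrict _ fun r hr => by simp [hψ' r hr, hψdot r hr.le], hsplit, hone]
  linarith
end

section
/- Rigidity for the damped pendulum-type ODE: let f(x) := (1/4) sin(2x) + (29/18) x cos(2x), and let x : ℝ → ℝ be a twice continuously differentiable solution of x''(t) + x'(t) = f(x(t)) for all t ∈ ℝ. If x(0) = 0 and there exists T > 0 with x(T) = 0, then x(t) = 0 for all t ∈ ℝ. -/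
open Real Set

/-- The sign of the remainders of the Taylor polynomials of `sin` and `cos` at `0`. -/
lemma sin_cos_taylor_sign (n : ℕ) : ∀ x : ℝ, 0 ≤ x →
    0 ≤ (-1) ^ (n + 1) *
      (cos x - ∑ k ∈ Finset.range (n + 1), (-1) ^ k * x ^ (2 * k) / ((2 * k).factorial : ℝ)) ∧
    0 ≤ (-1) ^ (n + 1) *
      (sin x - ∑ k ∈ Finset.range (n + 1), (-1) ^ k * x ^ (2 * k + 1) / ((2 * k + 1).factorial : ℝ)) := by
  have nonneg_of_deriv : ∀ g g' : ℝ → ℝ, g 0 = 0 → (∀ y, HasDerivAt g (g' y) y) →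
      (∀ y, 0 ≤ y → 0 ≤ g' y) → ∀ y, 0 ≤ y → 0 ≤ g y := by
    intro g g' h0 hg hg' y hy
    have hmono : MonotoneOn g (Ici 0) := by
      refine monotoneOn_of_deriv_nonneg (convex_Ici 0)
        (fun z _ => (hg z).continuousAt.continuousWithinAt)
        (fun z _ => (hg z).differentiableAt.differentiableWithinAt) fun z hz => ?_
      rw [interior_Ici] at hz
      rw [(hg z).deriv]
      exact hg' z (le_of_lt hz)
    simpa [h0] using hmono self_mem_Ici hy hy
  have deriv_sin_sum : ∀ (m : ℕ) (y : ℝ), HasDerivAt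
      (fun x : ℝ => ∑ k ∈ Finset.range m, (-1) ^ k * x ^ (2 * k + 1) / ((2 * k + 1).factorial : ℝ))
      (∑ k ∈ Finset.range m, (-1) ^ k * y ^ (2 * k) / ((2 * k).factorial : ℝ)) y := by
    intro m y
    refine HasDerivAt.fun_sum fun k _ => ?_
    refine (((hasDerivAt_pow (2 * k + 1) y).const_mul ((-1 : ℝ) ^ k)).div_const
      ((2 * k + 1).factorial : ℝ)).congr_deriv ?_
    rw [Nat.factorial_succ]
    have := Nat.factorial_ne_zero (2 * k)
    push_cast
    field_simp
  have deriv_cos_sum : ∀ (m : ℕ) (y : ℝ), HasDerivAt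
      (fun x : ℝ => ∑ k ∈ Finset.range (m + 1), (-1) ^ k * x ^ (2 * k) / ((2 * k).factorial : ℝ))
      (-∑ k ∈ Finset.range m, (-1) ^ k * y ^ (2 * k + 1) / ((2 * k + 1).factorial : ℝ)) y := by
    intro m y
    simp only [Finset.sum_range_succ' _ m]
    rw [← Finset.sum_neg_distrib]
    simp only [mul_zero, pow_zero]
    refine HasDerivAt.add_const _ (HasDerivAt.fun_sum fun k _ => ?_)
    refine (((hasDerivAt_pow (2 * (k + 1)) y).const_mul ((-1 : ℝ) ^ (k + 1))).div_const
      ((2 * (k + 1)).factorial : ℝ)).congr_deriv ?_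
    rw [show 2 * (k + 1) = 2 * k + 1 + 1 by ring, Nat.factorial_succ (2 * k + 1)]
    have := Nat.factorial_ne_zero (2 * k + 1)
    push_cast
    field_simp
    ring
  have sin_of_cos : ∀ m : ℕ, (∀ x : ℝ, 0 ≤ x → 0 ≤ (-1) ^ (m + 1) *
      (cos x - ∑ k ∈ Finset.range (m + 1), (-1) ^ k * x ^ (2 * k) / ((2 * k).factorial : ℝ))) →
      ∀ x : ℝ, 0 ≤ x → 0 ≤ (-1) ^ (m + 1) *
      (sin x - ∑ k ∈ Finset.range (m + 1), (-1) ^ k * x ^ (2 * k + 1) / ((2 * k + 1).factorial : ℝ)) :=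
    fun m hm => nonneg_of_deriv _ _ (by simp)
      (fun y => ((hasDerivAt_sin y).sub (deriv_sin_sum (m + 1) y)).const_mul _) hm
  induction n with
  | zero =>
    have hc : ∀ x : ℝ, 0 ≤ x → 0 ≤ (-1) ^ (0 + 1) *
        (cos x - ∑ k ∈ Finset.range (0 + 1), (-1) ^ k * x ^ (2 * k) / ((2 * k).factorial : ℝ)) := by
      intro x _
      simpa using cos_le_one x
    exact fun x hx => ⟨hc x hx, sin_of_cos 0 hc x hx⟩
  | succ n ih =>
    have hc : ∀ x : ℝ, 0 ≤ x → 0 ≤ (-1) ^ (n + 1 + 1) *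
        (cos x - ∑ k ∈ Finset.range (n + 1 + 1), (-1) ^ k * x ^ (2 * k) / ((2 * k).factorial : ℝ)) := by
      refine nonneg_of_deriv _ _ (by simp [Finset.sum_range_succ'])
        (fun y => ((hasDerivAt_cos y).sub (deriv_cos_sum (n + 1) y)).const_mul _) fun y hy => ?_
      have h := (ih y hy).2
      rw [pow_succ]
      linarith
    exact fun x hx => ⟨hc x hx, sin_of_cos (n + 1) hc x hx⟩

lemma sin_ge_taylor {x : ℝ} (hx : 0 ≤ x) :
    x - x ^ 3 / 6 + x ^ 5 / 120 - x ^ 7 / 5040 + x ^ 9 / 362880 - x ^ 11 / 39916800 ≤ sin x := by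
  have h := (sin_cos_taylor_sign 5 x hx).2
  norm_num [Finset.sum_range_succ, Nat.factorial] at h
  linarith

lemma cos_ge_taylor {x : ℝ} (hx : 0 ≤ x) :
    1 - x ^ 2 / 2 + x ^ 4 / 24 - x ^ 6 / 720 + x ^ 8 / 40320 - x ^ 10 / 3628800
      + x ^ 12 / 479001600 - x ^ 14 / 87178291200 ≤ cos x := by
  have h := (sin_cos_taylor_sign 7 x hx).1
  norm_num [Finset.sum_range_succ, Nat.factorial] at h
  linarith

/-- If a solution of `x'' + x' = f(x)` vanishes to first order at some time, it is zero. -/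
lemma eq_zero_of_cauchy_data {f x v : ℝ → ℝ} {C t₀ : ℝ} (hf : ∀ y, |f y| ≤ C * |y|)
    (hx : ∀ t, HasDerivAt x (v t) t) (hv : ∀ t, HasDerivAt v (f (x t) - v t) t)
    (hx₀ : x t₀ = 0) (hv₀ : v t₀ = 0) (t : ℝ) : x t = 0 := by
  have hC : 0 ≤ C := by simpa using (abs_nonneg _).trans (hf 1)
  have hN : ∀ s, HasDerivAt (fun s => x s ^ 2 + v s ^ 2)
      (2 * x s * v s + 2 * v s * (f (x s) - v s)) s := by
    intro s
    refine (((hx s).pow 2).add ((hv s).pow 2)).congr_deriv ?_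
    simp
  have hE : ∀ c s : ℝ, HasDerivAt (fun s => exp (c * s)) (c * exp (c * s)) s := by
    intro c s
    simpa [mul_comm] using ((hasDerivAt_id s).const_mul c).exp
  have hbound : ∀ s, |2 * x s * v s + 2 * v s * (f (x s) - v s)|
      ≤ (3 + C) * (x s ^ 2 + v s ^ 2) := by
    intro s
    have h₁ : |x s * v s| ≤ (x s ^ 2 + v s ^ 2) / 2 := by
      rw [abs_le]
      constructor <;> nlinarith [sq_nonneg (x s + v s), sq_nonneg (x s - v s)]
    have h₂ : |v s * f (x s)| ≤ C * ((x s ^ 2 + v s ^ 2) / 2) := by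
      calc |v s * f (x s)| = |v s| * |f (x s)| := abs_mul _ _
        _ ≤ |v s| * (C * |x s|) := by gcongr; exact hf _
        _ = C * |x s * v s| := by rw [abs_mul]; ring
        _ ≤ _ := by gcongr
    rw [abs_le] at *
    constructor <;> nlinarith [sq_nonneg (x s), sq_nonneg (v s)]
  have hzero : x t ^ 2 + v t ^ 2 ≤ 0 := by
    rcases le_total t t₀ with h | h
    · have hm : Monotone fun s => (x s ^ 2 + v s ^ 2) * exp ((3 + C) * s) := by
        refine monotone_of_deriv_nonneg
          (fun s => ((hN s).fun_mul (hE _ s)).differentiableAt) fun s => ?_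
        rw [((hN s).fun_mul (hE (3 + C) s)).deriv]
        nlinarith [(abs_le.1 (hbound s)).1, exp_pos ((3 + C) * s)]
      have := hm h
      simp only [hx₀, hv₀] at this
      nlinarith [exp_pos ((3 + C) * t)]
    · have hm : Antitone fun s => (x s ^ 2 + v s ^ 2) * exp (-(3 + C) * s) := by
        refine antitone_of_deriv_nonpos
          (fun s => ((hN s).fun_mul (hE _ s)).differentiableAt) fun s => ?_
        rw [((hN s).fun_mul (hE (-(3 + C)) s)).deriv]
        nlinarith [(abs_le.1 (hbound s)).2, exp_pos (-(3 + C) * s)]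
      have := hm h
      simp only [hx₀, hv₀] at this
      nlinarith [exp_pos (-(3 + C) * t)]
  nlinarith [sq_nonneg (x t), sq_nonneg (v t)]

/-- While a solution of `x'' + x' = f(x)` moves to the left, it cannot leave the region
`v² / 2 ≤ F(x) + R(x)`, provided `R'² < 2 (F + R)`. -/
lemma energy_barrier {f F R R' x v : ℝ → ℝ} {a b : ℝ}
    (hF : ∀ y, HasDerivAt F (f y) y) (hR : ∀ y, HasDerivAt R (R' y) y)
    (hx : ∀ t, HasDerivAt x (v t) t) (hv : ∀ t, HasDerivAt v (f (x t) - v t) t)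
    (hab : a ≤ b) (hneg : ∀ t ∈ Ico a b, v t ≤ 0)
    (hbar : ∀ t ∈ Ico a b, R' (x t) ^ 2 < 2 * (F (x t) + R (x t)))
    (ha : v a ^ 2 ≤ 2 * (F (x a) + R (x a))) : v b ^ 2 ≤ 2 * (F (x b) + R (x b)) := by
  have hφ : ∀ t, HasDerivAt (fun t => v t ^ 2 - 2 * (F (x t) + R (x t)))
      (-(2 * v t * (v t + R' (x t)))) t := by
    intro t
    refine (((hv t).pow 2).sub ((((hF (x t)).comp t (hx t)).add
      ((hR (x t)).comp t (hx t))).const_mul 2)).congr_deriv ?_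
    simp
    ring
  have := image_le_of_deriv_right_lt_deriv_boundary'
    (f := fun t => v t ^ 2 - 2 * (F (x t) + R (x t))) (B := fun _ => 0) (B' := fun _ => 0)
    (fun t _ => (hφ t).continuousAt.continuousWithinAt)
    (fun t _ => (hφ t).hasDerivWithinAt) (by simpa using ha) continuousOn_const
    (fun t _ => hasDerivWithinAt_const _ _ _) (fun t ht h => ?_) (right_mem_Icc.2 hab)
  · simpa using this
  · have h₁ := hbar t ht
    have h₂ := hneg t ht
    have h₃ : |R' (x t)| < |v t| := sq_lt_sq.1 (by linarith)
    rw [abs_of_nonpos h₂] at h₃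
    have h₄ := (abs_lt.1 h₃).2
    have h₅ : v t < 0 := by linarith [abs_nonneg (R' (x t))]
    nlinarith

/-- A solution of `x'' + x' = f(x)` turning back at a positive position and reaching `0` afterwards
arrives there with zero velocity, provided barriers `R₁` on `(0, X]` and `R₂` on `[X, ∞)` exist. -/
lemma velocity_eq_zero_of_descent {f F R₁ R₁' R₂ R₂' x v : ℝ → ℝ} {X a b : ℝ}
    (hF : ∀ y, HasDerivAt F (f y) y) (hF₀ : F 0 = 0)
    (hR₁ : ∀ y, HasDerivAt R₁ (R₁' y) y) (hR₁₀ : R₁ 0 = 0)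
    (hR₂ : ∀ y, HasDerivAt R₂ (R₂' y) y) (hX : 0 < X)
    (hbar₁ : ∀ y, 0 < y → y ≤ X → R₁' y ^ 2 < 2 * (F y + R₁ y))
    (hbar₂ : ∀ y, X ≤ y → R₂' y ^ 2 < 2 * (F y + R₂ y)) (hR : R₂ X ≤ R₁ X)
    (hx : ∀ t, HasDerivAt x (v t) t) (hv : ∀ t, HasDerivAt v (f (x t) - v t) t)
    (hab : a ≤ b) (hneg : ∀ t ∈ Icc a b, v t ≤ 0) (hpos : ∀ t ∈ Ico a b, 0 < x t)
    (hva : v a = 0) (hxb : x b = 0) : v b = 0 := by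
  have hanti : AntitoneOn x (Icc a b) := by
    refine antitoneOn_of_deriv_nonpos (convex_Icc a b)
      (fun t _ => (hx t).continuousAt.continuousWithinAt)
      (fun t _ => (hx t).differentiableAt.differentiableWithinAt) fun t ht => ?_
    rw [(hx t).deriv]
    exact hneg t (interior_subset ht)
  have finish : ∀ c ∈ Icc a b, x c ≤ X → v c ^ 2 ≤ 2 * (F (x c) + R₁ (x c)) → v b = 0 := by
    intro c hc hxc hvc
    have h := energy_barrier hF hR₁ hx hv hc.2
      (fun t ht => hneg t ⟨hc.1.trans ht.1, ht.2.le⟩)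
      (fun t ht => hbar₁ _ (hpos t ⟨hc.1.trans ht.1, ht.2⟩)
        ((hanti hc ⟨hc.1.trans ht.1, ht.2.le⟩ ht.1).trans hxc)) hvc
    rw [hxb, hF₀, hR₁₀] at h
    nlinarith
  rcases hab.eq_or_lt with rfl | hab'
  · exact hva
  have hxa : 0 < x a := hpos a ⟨le_rfl, hab'⟩
  rcases le_or_gt (x a) X with h | h
  · refine finish a ⟨le_rfl, hab⟩ h ?_
    rw [hva]
    nlinarith [hbar₁ _ hxa h, sq_nonneg (R₁' (x a))]
  · obtain ⟨c, hc, hxc⟩ : X ∈ x '' Icc a b :=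
      intermediate_value_Icc' hab (fun t _ => (hx t).continuousAt.continuousWithinAt)
        ⟨by linarith, h.le⟩
    refine finish c hc hxc.le ?_
    have := energy_barrier hF hR₂ hx hv hc.1
      (fun t ht => hneg t ⟨ht.1, ht.2.le.trans hc.2⟩)
      (fun t ht => hbar₂ _ (hxc ▸ hanti ⟨ht.1, ht.2.le.trans hc.2⟩ hc ht.2.le))
      (by rw [hva]; nlinarith [hbar₂ _ h.le, sq_nonneg (R₂' (x a))])
    rw [hxc] at this ⊢
    linarith

/-- A trajectory starting at `0` with positive velocity and returning to `0` later contains a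
descent from a turning point to `0`. -/
lemma exists_descent {x v : ℝ → ℝ} {T : ℝ} (hx : ∀ t, HasDerivAt x (v t) t)
    (hv : Continuous v) (hT : 0 < T) (hx₀ : x 0 = 0) (hxT : x T = 0) (hv₀ : 0 < v 0) :
    ∃ a b, a ≤ b ∧ (∀ t ∈ Icc a b, v t ≤ 0) ∧ (∀ t ∈ Ico a b, 0 < x t) ∧ v a = 0 ∧ x b = 0 ∧
      ∃ s, x s ≠ 0 := by
  have hxc : Continuous x := continuous_iff_continuousAt.2 fun t => (hx t).continuousAt
  obtain ⟨m, hm, hmax⟩ := isCompact_Icc.exists_isMaxOn (nonempty_Icc.2 hT.le) hxc.continuousOn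
  have hxm : 0 < x m := by
    by_contra! hle
    have hmax₀ : ∀ t ∈ Icc 0 T, x t ≤ 0 := fun t ht => (hmax ht).trans hle
    obtain ⟨ε, hε, hmono⟩ : ∃ ε > 0, ∀ t ∈ Icc 0 ε, 0 < v t := by
      have := (hv.tendsto 0).eventually (lt_mem_nhds hv₀)
      obtain ⟨ε, hε, h⟩ := Metric.eventually_nhds_iff.1 this
      refine ⟨ε / 2, by positivity, fun t ht => h ?_⟩
      rw [dist_zero_right, norm_eq_abs, abs_of_nonneg ht.1]
      linarith [ht.2]
    have hδ : 0 < min ε T := lt_min hε hT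
    obtain ⟨ξ, hξ, hslope⟩ := exists_hasDerivAt_eq_slope x v hδ hxc.continuousOn
      fun t _ => hx t
    have h₁ := hmono ξ ⟨hξ.1.le, hξ.2.le.trans (min_le_left _ _)⟩
    rw [hslope, hx₀, sub_zero, sub_zero] at h₁
    have h₂ := hmax₀ _ ⟨hδ.le, min_le_right _ _⟩
    exact absurd h₁ (div_nonpos_of_nonpos_of_nonneg h₂ hδ.le).not_gt
  have hvm : v m = 0 := by
    have hne₀ : m ≠ 0 := fun h => hxm.ne' (h ▸ hx₀)
    have hneT : m ≠ T := fun h => hxm.ne' (h ▸ hxT)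
    have hlm : IsLocalMax x m := hmax.isLocalMax
      (Icc_mem_nhds (lt_of_le_of_ne hm.1 hne₀.symm) (lt_of_le_of_ne hm.2 hneT))
    exact hlm.hasDerivAt_eq_zero (hx m)
  obtain ⟨b, ⟨⟨hmb, hbT⟩, hxb⟩, hbmin⟩ :=
    (isCompact_Icc.inter_right (isClosed_singleton.preimage hxc)).exists_isLeast
      (s := Icc m T ∩ x ⁻¹' {0}) ⟨T, ⟨hm.2, le_rfl⟩, hxT⟩
  have hxb : x b = 0 := hxb
  have hpos : ∀ t ∈ Ico m b, 0 < x t := by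
    intro t ht
    by_contra! hle
    obtain ⟨s, hs, hxs⟩ := intermediate_value_Icc' ht.1 hxc.continuousOn ⟨hle, hxm.le⟩
    exact absurd (hbmin ⟨⟨hs.1, hs.2.trans (ht.2.le.trans hbT)⟩, hxs⟩)
      (hs.2.trans_lt ht.2).not_ge
  obtain ⟨a, ⟨⟨hma, hab⟩, hva⟩, hamax⟩ :=
    (isCompact_Icc.inter_right (isClosed_singleton.preimage hv)).exists_isGreatest
      (s := Icc m b ∩ v ⁻¹' {0}) ⟨m, ⟨le_rfl, hmb⟩, hvm⟩
  have hva : v a = 0 := hva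
  refine ⟨a, b, hab, fun t ht => ?_, fun t ht => hpos t ⟨hma.trans ht.1, ht.2⟩, hva, hxb,
    m, hxm.ne'⟩
  by_contra! hvt
  have hat : a < t := lt_of_le_of_ne ht.1 fun h => hvt.ne' (h ▸ hva)
  obtain ⟨ξ, hξ, hslope⟩ := exists_hasDerivAt_eq_slope x v (hat.trans_le ht.2) hxc.continuousOn
    fun t _ => hx t
  have hvξ : v ξ ≤ 0 := by
    rw [hslope, hxb]
    exact div_nonpos_of_nonpos_of_nonneg
      (by linarith [hpos a ⟨hma, hat.trans_le ht.2⟩]) (by linarith)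
  obtain ⟨s, hs, hvs⟩ := intermediate_value_uIcc hv.continuousOn
    (mem_uIcc_of_le hvξ hvt.le : (0 : ℝ) ∈ uIcc (v ξ) (v t))
  have has : a < s := (lt_min hξ.1 hat).trans_le hs.1
  have hsb : s ≤ b := hs.2.trans (max_le hξ.2.le ht.2)
  exact absurd (hamax ⟨⟨hma.trans has.le, hsb⟩, hvs⟩) has.not_ge

/-- The primitive of the nonlinearity that vanishes at `0`. -/
noncomputable def primitive (y : ℝ) : ℝ := 29 / 36 * y * sin (2 * y) - 5 / 9 * sin y ^ 2

lemma hasDerivAt_primitive (y : ℝ) : HasDerivAt primitive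
    (1 / 4 * sin (2 * y) + 29 / 18 * y * cos (2 * y)) y := by
  have h2 : HasDerivAt (fun y : ℝ => 2 * y) 2 y := by simpa using (hasDerivAt_id y).const_mul 2
  refine ((((hasDerivAt_id y).const_mul (29 / 36)).mul h2.sin).sub
    (((hasDerivAt_sin y).pow 2).const_mul (5 / 9))).congr_deriv ?_
  simp only [id, sin_two_mul]
  norm_num
  ring

lemma abs_nonlinearity_le (y : ℝ) :
    |1 / 4 * sin (2 * y) + 29 / 18 * y * cos (2 * y)| ≤ 19 / 9 * |y| := by
  have h₁ : |sin (2 * y)| ≤ 2 * |y| := by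
    simpa [abs_mul] using abs_sin_le_abs (x := 2 * y)
  have h₂ : |y * cos (2 * y)| ≤ |y| := by
    rw [abs_mul]
    exact mul_le_of_le_one_right (abs_nonneg y) (abs_cos_le_one _)
  rw [abs_le] at *
  constructor <;> linarith

lemma inner_barrier {y : ℝ} (hy : 0 < y) (hyX : y ≤ 47 / 20) :
    (2 * y - 3 / 5 * y ^ 3 + 1 / 10 * y ^ 4) ^ 2
      < 2 * (primitive y + (y ^ 2 - 3 / 20 * y ^ 4 + 1 / 50 * y ^ 5)) := by
  have hs := sin_ge_taylor (x := 2 * y) (by linarith)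
  have hc := cos_ge_taylor (x := 2 * y) (by linarith)
  have hsq : sin y ^ 2 = (1 - cos (2 * y)) / 2 := by rw [cos_two_mul, sin_sq]; ring
  have hys := mul_le_mul_of_nonneg_left hs hy.le
  have hpoly : 0 < 1/9 + (29/90) * y ^ 2 + (-9/25) * y ^ 3 + (41/2025) * y ^ 4 + (3/25) * y ^ 5 +
      (-2687/56700) * y ^ 6 + (2/945) * y ^ 8 + (-328/4209975) * y ^ 10 + (-8/76621545) * y ^ 12 := by
    obtain ⟨s, rfl⟩ : ∃ s, y = 47 / 20 * s := ⟨20 / 47 * y, by ring⟩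
    have hs₀ : 0 < s := by linarith
    have hs₁ : 0 ≤ 1 - s := by linarith
    calc (0 : ℝ) < (1/9 : ℝ) * (1 - s) ^ 12 +
      (4/3 : ℝ) * s * (1 - s) ^ 11 +
      (328061/36000 : ℝ) * s ^ 2 * (1 - s) ^ 10 +
      (22540279/600000 : ℝ) * s ^ 3 * (1 - s) ^ 9 +
      (30341117861/324000000 : ℝ) * s ^ 4 * (1 - s) ^ 8 +
      (951806819261/6480000000 : ℝ) * s ^ 5 * (1 - s) ^ 7 +
      (20619118208611/134400000000 : ℝ) * s ^ 6 * (1 - s) ^ 6 +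
      (208745721956411/1814400000000 : ℝ) * s ^ 7 * (1 - s) ^ 5 +
      (2413022689587833/36288000000000 : ℝ) * s ^ 8 * (1 - s) ^ 4 +
      (88803974443711/3024000000000 : ℝ) * s ^ 9 * (1 - s) ^ 3 +
      (47430351089650395991/5388768000000000000 : ℝ) * s ^ 10 * (1 - s) ^ 2 +
      (3790023764121153991/2694384000000000000 : ℝ) * s ^ 11 * (1 - s) +
      (792875018433803636239/39230231040000000000000 : ℝ) * s ^ 12 := by positivity
      _ = _ := by ring
  have := mul_pos (pow_pos hy 2) hpoly
  rw [primitive, hsq]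
  linarith

lemma outer_barrier {c d : ℝ} (hc : 0 ≤ c) (hd : (29 / 36 + c) ^ 2 < 2 * d) (y : ℝ) :
    (y + 29 / 36 * sin (2 * y) - c) ^ 2
      < 2 * (primitive y + (y ^ 2 / 2 + 29 / 36 * sin y ^ 2 + d - c * y)) := by
  have h : (29 / 36 * sin (2 * y) - c) ^ 2 ≤ (29 / 36 + c) ^ 2 := by
    apply sq_le_sq'
    · linarith [neg_one_le_sin (2 * y)]
    · linarith [sin_le_one (2 * y)]
  rw [primitive]
  nlinarith [sq_nonneg (sin y)]

/-- A solution that starts at `0` and returns to it later has nonpositive initial velocity. -/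
lemma velocity_nonpos_of_return {x v : ℝ → ℝ} {T : ℝ} (hx : ∀ t, HasDerivAt x (v t) t)
    (hv : ∀ t, HasDerivAt v
      ((1 / 4 * sin (2 * x t) + 29 / 18 * x t * cos (2 * x t)) - v t) t)
    (hT : 0 < T) (hx₀ : x 0 = 0) (hxT : x T = 0) : v 0 ≤ 0 := by
  by_contra! hv₀
  obtain ⟨a, b, hab, hneg, hpos, hva, hxb, s, hs⟩ := exists_descent hx
    (continuous_iff_continuousAt.2 fun t => (hv t).continuousAt) hT hx₀ hxT hv₀
  set d : ℝ := ((47 / 20) ^ 2 - 3 / 20 * (47 / 20) ^ 4 + 1 / 50 * (47 / 20) ^ 5)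
    - (47 / 20) ^ 2 / 2 - 29 / 36 * sin (47 / 20) ^ 2 + 31 / 20 * (47 / 20) with hd
  have hd' : (29 / 36 + 31 / 20) ^ 2 < 2 * d := by
    have hc := cos_ge_taylor (x := 2 * (47 / 20)) (by norm_num)
    have hsq : sin (47 / 20) ^ 2 = (1 - cos (2 * (47 / 20))) / 2 := by
      rw [cos_two_mul, sin_sq]; ring
    rw [hd, hsq]
    norm_num at hc ⊢
    linarith
  refine hs (eq_zero_of_cauchy_data
    (f := fun y => 1 / 4 * sin (2 * y) + 29 / 18 * y * cos (2 * y)) abs_nonlinearity_le hx hv hxb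
    (velocity_eq_zero_of_descent (X := 47 / 20)
      (R₁ := fun y => y ^ 2 - 3 / 20 * y ^ 4 + 1 / 50 * y ^ 5)
      (R₁' := fun y => 2 * y - 3 / 5 * y ^ 3 + 1 / 10 * y ^ 4)
      (R₂ := fun y => y ^ 2 / 2 + 29 / 36 * sin y ^ 2 + d - 31 / 20 * y)
      (R₂' := fun y => y + 29 / 36 * sin (2 * y) - 31 / 20)
      hasDerivAt_primitive (by simp [primitive]) (fun y => ?_) (by simp) (fun y => ?_)
      (by norm_num) (fun y => inner_barrier) (fun y _ => outer_barrier (by norm_num) hd' y) ?_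
      hx hv hab hneg hpos hva hxb) s)
  · refine (((hasDerivAt_pow 2 y).sub ((hasDerivAt_pow 4 y).const_mul (3 / 20))).add
      ((hasDerivAt_pow 5 y).const_mul (1 / 50))).congr_deriv ?_
    norm_num
    ring
  · refine (((((hasDerivAt_pow 2 y).div_const 2).add
      (((hasDerivAt_sin y).pow 2).const_mul (29 / 36))).add_const d).sub
      ((hasDerivAt_id y).const_mul (31 / 20))).congr_deriv ?_
    rw [sin_two_mul]
    norm_num
  · rw [hd]
    apply le_of_eq
    ring

/-- Rigidity for the damped pendulum-type ODE `x'' + x' = f(x)` with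
`f(x) = (1/4) sin 2x + (29/18) x cos 2x`: a global `C²` solution vanishing at
`t = 0` and at some `T > 0` vanishes identically. -/
theorem ode_rigidity
    (x : ℝ → ℝ) (hx : ContDiff ℝ 2 x)
    (heq : ∀ t : ℝ, deriv (deriv x) t + deriv x t
      = (1/4) * Real.sin (2 * x t) + (29/18) * x t * Real.cos (2 * x t))
    (h0 : x 0 = 0) (hT : ∃ T > (0:ℝ), x T = 0) :
    ∀ t : ℝ, x t = 0 := by
  obtain ⟨T, hT, hxT⟩ := hT
  have hd : ∀ t, HasDerivAt x (deriv x t) t := fun t =>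
    ((hx.differentiable (by norm_num)) t).hasDerivAt
  have hdd : ∀ t, HasDerivAt (deriv x)
      ((1 / 4 * sin (2 * x t) + 29 / 18 * x t * cos (2 * x t)) - deriv x t) t := fun t => by
    have h : ContDiff ℝ 1 (deriv x) := (contDiff_succ_iff_deriv.1 hx).2.2
    exact ((h.differentiable (by norm_num)) t).hasDerivAt.congr_deriv (by linarith [heq t])
  have hle : deriv x 0 ≤ 0 := velocity_nonpos_of_return hd hdd hT h0 hxT
  have hge : -deriv x 0 ≤ 0 := by
    refine velocity_nonpos_of_return (x := fun t => -x t) (v := fun t => -deriv x t)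
      (fun t => (hd t).neg) (fun t => (hdd t).neg.congr_deriv ?_) hT (by simp [h0]) (by simp [hxT])
    simp only [mul_neg, sin_neg, cos_neg]
    ring
  exact eq_zero_of_cauchy_data (f := fun y => 1 / 4 * sin (2 * y) + 29 / 18 * y * cos (2 * y))
    abs_nonlinearity_le hd hdd h0 (by linarith)
end

section
/- Location of the first positive zero of the perturbed sine: let g(ζ) := (1/4) cos(2ζ) − (29/18) ζ sin(2ζ) and, for ε ∈ ℝ, h_ε(ζ) := sin(2ζ) − ε² g(ζ). Then for every ε ∈ [0, 7/20] there exists a ∈ [−1/3, −1/9] such that h_ε( (ε²/8)(1 + a ε⁴) ) = 0. -/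
open Set

/-- With `y = 2ζ` and `t = ε²`, the function `h_ε` is nonpositive at `y = (t/4)(1 - t²/3)`. -/
lemma perturbed_sine_nonpos {t y : ℝ} (ht : 0 ≤ t) (ht' : t ≤ 1 / 4)
    (hy : y = t / 4 - t ^ 3 / 12) :
    Real.sin y - t * (1 / 4 * Real.cos y - 29 / 36 * y * Real.sin y) ≤ 0 := by
  have hy0 : 0 ≤ y := by
    have : 0 ≤ t * (3 - t ^ 2) := mul_nonneg ht (by nlinarith)
    linarith
  have hyt : y ≤ t / 4 := by linarith [pow_nonneg ht 3]
  have hsin : Real.sin y ≤ y := Real.sin_le hy0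
  have hcos : 1 - y ^ 2 / 2 ≤ Real.cos y := Real.one_sub_sq_div_two_le_cos
  have h1 : t * y * Real.sin y ≤ t * y * y := by gcongr
  have h2 : t * (1 - y ^ 2 / 2) ≤ t * Real.cos y := by gcongr
  have h3 : t * y ^ 2 ≤ t * (t / 4) ^ 2 := by gcongr
  linarith [pow_nonneg ht 3]

/-- With `y = 2ζ` and `t = ε²`, the function `h_ε` is nonnegative at `y = (t/4)(1 - t²/9)`. -/
lemma perturbed_sine_nonneg {t y : ℝ} (ht : 0 ≤ t) (ht' : t ≤ 1 / 4)
    (hy : y = t / 4 - t ^ 3 / 36) :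
    0 ≤ Real.sin y - t * (1 / 4 * Real.cos y - 29 / 36 * y * Real.sin y) := by
  have ht2 : t ^ 2 ≤ 1 / 16 := by nlinarith
  have ht3 : t ^ 3 ≤ t / 16 := by nlinarith
  have hy0 : 143 / 576 * t ≤ y := by linarith
  have hyt : y ≤ t / 4 := by linarith [pow_nonneg ht 3]
  have hy0' : 0 ≤ y := by linarith
  have hsin : y - y ^ 3 / 6 ≤ Real.sin y := by
    rcases hy0'.eq_or_lt with h | h
    · simp [← h]
    · exact (Real.sin_gt_sub_cube h).le
  have hy3 : y ^ 3 ≤ (t / 4) ^ 3 := by gcongr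
  have hlow : 6 / 25 * t ≤ Real.sin y := by linarith
  have h1 : t * (143 / 576 * t) * (6 / 25 * t) ≤ t * y * Real.sin y := by gcongr
  have h2 : t * Real.cos y ≤ t * 1 := by gcongr; exact Real.cos_le_one y
  linarith [pow_nonneg ht 3]

/-- Location of the first positive zero of `h_ε(ζ) = sin 2ζ − ε² g(ζ)` with
`g(ζ) = (1/4) cos 2ζ − (29/18) ζ sin 2ζ`: it is at `(ε²/8)(1 + a ε⁴)` for
some `a ∈ [−1/3, −1/9]`. -/
theorem first_zero_perturbed_sine :
    ∀ ε ∈ Icc (0:ℝ) (7/20), ∃ a ∈ Icc (-(1:ℝ)/3) (-(1:ℝ)/9),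
      Real.sin (2 * ((ε ^ 2 / 8) * (1 + a * ε ^ 4)))
        - ε ^ 2 * ((1/4) * Real.cos (2 * ((ε ^ 2 / 8) * (1 + a * ε ^ 4)))
            - (29/18) * ((ε ^ 2 / 8) * (1 + a * ε ^ 4))
              * Real.sin (2 * ((ε ^ 2 / 8) * (1 + a * ε ^ 4)))) = 0 := by
  rintro ε ⟨h0, h1⟩
  have ht : ε ^ 2 ≤ 1 / 4 := by nlinarith
  refine intermediate_value_Icc (by norm_num) (Continuous.continuousOn (by fun_prop)) ⟨?_, ?_⟩
  · refine le_of_eq_of_le ?_ (perturbed_sine_nonpos (sq_nonneg ε) ht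
      (y := 2 * ((ε ^ 2 / 8) * (1 + -(1:ℝ) / 3 * ε ^ 4))) (by ring))
    ring
  · refine le_of_le_of_eq (perturbed_sine_nonneg (sq_nonneg ε) ht
      (y := 2 * ((ε ^ 2 / 8) * (1 + -(1:ℝ) / 9 * ε ^ 4))) (by ring)) ?_
    ring
end

section
/- Positivity of the first Lyapunov comparison function: let g(x) := (1/4) cos(2x) − (29/18) x sin(2x) and β := 5/4. Define F₁(x, ε) := 2 g(x) ε² − 2β sin(x) ε + (β² − 2) sin(2x). Then F₁(x, ε) ≥ 0 for every (x, ε) ∈ [2, π] × [0, 7/20]. -/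
open Set

lemma cos_two_le_neg : Real.cos 2 ≤ -(39 / 100) := by
  have hb := (abs_le.mp (Real.cos_bound (x := 1) (by norm_num))).2
  norm_num at hb
  have h0 := Real.cos_one_pos
  have h2 : Real.cos 2 = 2 * Real.cos 1 ^ 2 - 1 := by rw [← Real.cos_two_mul]; norm_num
  have h1 : Real.cos 1 ≤ 53 / 96 := by linarith
  nlinarith

/-- Positivity of the first Lyapunov comparison function
`F₁(x,ε) = 2 g(x) ε² − 2β sin(x) ε + (β² − 2) sin 2x`, `β = 5/4`,
`g(x) = (1/4) cos 2x − (29/18) x sin 2x`, on `[2,π] × [0, 7/20]`. -/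
theorem F1_nonneg :
    ∀ x ∈ Icc (2:ℝ) Real.pi, ∀ ε ∈ Icc (0:ℝ) (7/20),
      2 * ((1/4) * Real.cos (2 * x) - (29/18) * x * Real.sin (2 * x)) * ε ^ 2
        - 2 * (5/4) * Real.sin x * ε
        + ((5/4) ^ 2 - 2) * Real.sin (2 * x) ≥ 0 := by
  rintro x ⟨hx2, hxpi⟩ ε -
  have hs : 0 ≤ Real.sin x := Real.sin_nonneg_of_nonneg_of_le_pi (by linarith) hxpi
  have hc : Real.cos x ≤ -(39 / 100) :=
    (Real.cos_le_cos_of_nonneg_of_le_pi (by norm_num) hxpi hx2).trans cos_two_le_neg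
  have hsc := Real.sin_sq_add_cos_sq x
  rw [Real.cos_two_mul, Real.sin_two_mul]
  generalize Real.sin x = s at *
  obtain ⟨c, hcdef⟩ : ∃ c, Real.cos x = -c := ⟨-Real.cos x, by ring⟩
  rw [hcdef] at hc hsc ⊢
  have hc' : 39 / 100 ≤ c := by linarith
  have hs1 : s ≤ 921 / 1000 := by nlinarith
  have hcos : 0 ≤ 2 * c ^ 2 - 1 + 189 / 250 * s := by nlinarith
  have hquad : 0 ≤ ε ^ 2 * (116 / 9 * c - 189 / 500) - 5 / 2 * ε + 7 / 8 * c := by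
    have hmono := mul_le_mul_of_nonneg_left hc' (sq_nonneg ε)
    nlinarith [sq_nonneg (ε - 27 / 100)]
  have hx : 0 ≤ (x - 2) * (s * c * ε ^ 2) :=
    mul_nonneg (by linarith) (mul_nonneg (mul_nonneg hs (by linarith)) (sq_nonneg ε))
  have hcosε := mul_nonneg hcos (sq_nonneg ε)
  have hquads := mul_nonneg hs hquad
  linarith
end

section
/- Positivity of the second Lyapunov comparison function: let g(x) := (1/4) cos(2x) − (29/18) x sin(2x), α := 6/5 and β := 5/4. Define F₂(x, ε) := g(x) ε² − ε (β sin(2)/α) √(α² − (x−2)²) − ( β² sin²(2) (x − 2) + α sin(2x) ) / α². Then F₂(x, ε) ≥ 0 for every (x, ε) ∈ [7/4, 2] × [0, 7/20]. -/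
open Set

lemma nine_tenths_le_sin_two : (9/10 : ℝ) ≤ Real.sin 2 := by
  have hπ₁ := Real.pi_gt_d4
  have hπ₂ := Real.pi_lt_d4
  have h := Real.one_sub_sq_div_two_le_cos (x := 2 - Real.pi / 2)
  rw [Real.cos_sub_pi_div_two] at h
  nlinarith

/-- An affine lower bound for `-sin 2x`, from `y - y ^ 3 / 6 < sin y` at `y = 2x - π`. -/
lemma affine_le_neg_sin_two_mul {x : ℝ} (hx : x ∈ Icc (7/4 : ℝ) 2) :
    34/100 + (6/10) * (2 * x - 7/2) ≤ -Real.sin (2 * x) := by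
  obtain ⟨hx₁, hx₂⟩ := hx
  have hπ₁ := Real.pi_gt_d4
  have hπ₂ := Real.pi_lt_d4
  have h := Real.sin_gt_sub_cube (x := 2 * x - Real.pi) (by linarith)
  rw [Real.sin_sub_pi] at h
  have hy₁ : 358/1000 ≤ 2 * x - Real.pi := by linarith
  have hy₂ : 2 * x - Real.pi ≤ 859/1000 := by linarith
  have hxy : 2 * x ≤ (2 * x - Real.pi) + 31416/10000 := by linarith
  generalize 2 * x - Real.pi = y at *
  nlinarith [mul_nonneg (mul_nonneg (sub_nonneg.2 hy₁) (sub_nonneg.2 hy₂))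
    (by linarith : 0 ≤ y + 1)]

/-- Positivity of the second Lyapunov comparison function
`F₂(x,ε) = g(x) ε² − ε (β sin 2 / α) √(α² − (x−2)²)
  − (β² sin²2 (x−2) + α sin 2x)/α²`, with `α = 6/5`, `β = 5/4`,
`g(x) = (1/4) cos 2x − (29/18) x sin 2x`, on `[7/4, 2] × [0, 7/20]`. -/
theorem F2_nonneg :
    ∀ x ∈ Icc (7/4 : ℝ) 2, ∀ ε ∈ Icc (0:ℝ) (7/20),
      ((1/4) * Real.cos (2 * x) - (29/18) * x * Real.sin (2 * x)) * ε ^ 2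
        - ε * ((5/4) * Real.sin 2 / (6/5)) * Real.sqrt ((6/5) ^ 2 - (x - 2) ^ 2)
        - ((5/4) ^ 2 * Real.sin 2 ^ 2 * (x - 2) + (6/5) * Real.sin (2 * x)) / (6/5) ^ 2
      ≥ 0 := by
  intro x hx ε hε
  have hS := affine_le_neg_sin_two_mul hx
  obtain ⟨hx₁, hx₂⟩ := hx
  obtain ⟨hε₀, hε₁⟩ := hε
  have hs₁ := nine_tenths_le_sin_two
  have hs₂ := Real.sin_le_one 2
  have hg : 0 ≤ (1/4) * Real.cos (2 * x) - (29/18) * x * Real.sin (2 * x) := by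
    nlinarith [Real.neg_one_le_cos (2 * x)]
  have hsqrt : Real.sqrt ((6/5) ^ 2 - (x - 2) ^ 2) ≤ 6/5 :=
    Real.sqrt_le_iff.2 ⟨by norm_num, by nlinarith [sq_nonneg (x - 2)]⟩
  have hmid : ε * ((5/4) * Real.sin 2 / (6/5)) * Real.sqrt ((6/5) ^ 2 - (x - 2) ^ 2)
      ≤ 7/20 * ((5/4) * 1 / (6/5)) * (6/5) := by gcongr
  have hsq : (81/100) * (2 - x) ≤ Real.sin 2 ^ 2 * (2 - x) :=
    mul_le_mul_of_nonneg_right (by nlinarith) (by linarith)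
  have hlast : ((5/4) ^ 2 * Real.sin 2 ^ 2 * (x - 2) + (6/5) * Real.sin (2 * x)) / (6/5) ^ 2
      ≤ -(7/20 * (5/4)) := by
    rw [div_le_iff₀ (by norm_num)]
    linarith
  linarith [mul_nonneg hg (sq_nonneg ε)]
end

section
/- The derivative of f is large at every positive zero of f: let f(x) := (1/4) sin(2x) + (29/18) x cos(2x). Then for every x > 0 with f(x) = 0 one has |f'(x)| > 1. -/
/-- At every positive zero of `f(x) = (1/4) sin 2x + (29/18) x cos 2x`, the
derivative of `f` has absolute value greater than `1`. -/
theorem deriv_large_at_positive_zeros :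
    ∀ x : ℝ, 0 < x →
      (1/4) * Real.sin (2 * x) + (29/18) * x * Real.cos (2 * x) = 0 →
      1 < |deriv (fun y : ℝ =>
            (1/4) * Real.sin (2 * y) + (29/18) * y * Real.cos (2 * y)) x| := by
  intro x _ hzero
  have hderiv : HasDerivAt (fun y : ℝ =>
      (1/4) * Real.sin (2 * y) + (29/18) * y * Real.cos (2 * y))
      ((19/9) * Real.cos (2 * x) - (29/9) * x * Real.sin (2 * x)) x := by
    have hlin : HasDerivAt (fun y : ℝ => 2 * y) 2 x := by
      simpa using (hasDerivAt_id x).const_mul 2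
    have hcoeff : HasDerivAt (fun y : ℝ => (29/18) * y) (29/18) x := by
      simpa using (hasDerivAt_id x).const_mul (29/18)
    exact ((hlin.sin.const_mul (1/4)).add (hcoeff.mul hlin.cos)).congr_deriv (by ring)
  rw [hderiv.deriv]
  have hsin : Real.sin (2 * x) = -(58/9) * x * Real.cos (2 * x) := by linarith
  have hsq := Real.sin_sq_add_cos_sq (2 * x)
  rw [hsin] at hsq ⊢
  generalize Real.cos (2 * x) = c at hsq ⊢
  have hc : 0 < c ^ 2 := by
    have hne : c ≠ 0 := by
      rintro rfl
      norm_num at hsq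
    positivity
  rw [← one_lt_sq_iff_one_lt_abs]
  calc 1 = c ^ 2 * (1 + (3364/81) * x ^ 2) := by linarith
    _ < c ^ 2 * (19/9 + (1682/81) * x ^ 2) ^ 2 := by
      gcongr
      nlinarith [sq_nonneg x, sq_nonneg (x ^ 2)]
    _ = _ := by ring
end

section
/- Uniform bound on the free distorted Fourier basis: let φ₀(r; λ) := (λ³ r)^{-1} [ (1 + λ² r) sin(λ(r−1)) − λ(r−1) cos(λ(r−1)) ] for r ≥ 1 and λ > 0. Then there exists a constant C > 0 such that for all r ≥ 1 and all λ > 0, |φ₀(r; λ)| · λ²/(1 + λ) ≤ C · min(1, λ(r − 1)). In particular, with ω₀(λ) := 2λ⁴/(1 + λ²), one has sup over r ≥ 1 and λ > 0 of |φ₀(r; λ)|² ω₀(λ) < ∞. -/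
theorem abs_sin_sub_mul_cos_le {x : ℝ} (hx : 0 ≤ x) :
    |Real.sin x - x * Real.cos x| ≤ 2 * (min 1 x * x) := by
  rcases le_total x 1 with h | h
  · rw [min_eq_right h, abs_le]
    rcases hx.eq_or_lt with rfl | hpos
    · simp
    have hs := Real.sin_gt_sub_cube hpos
    have hs' := Real.sin_le hx
    have hc := mul_le_mul_of_nonneg_left (Real.one_sub_sq_div_two_le_cos (x := x)) hx
    have hc' := mul_le_mul_of_nonneg_left (Real.cos_le_one x) hx
    have hcube : x ^ 3 ≤ x * x := by nlinarith [mul_nonneg hx hx]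
    constructor <;> nlinarith [mul_nonneg hx hx]
  · rw [min_eq_left h, abs_le]
    have hc := mul_le_mul_of_nonneg_left (Real.cos_le_one x) hx
    have hc' := mul_le_mul_of_nonneg_left (Real.neg_one_le_cos x) hx
    constructor <;> linarith [Real.sin_le_one x, Real.neg_one_le_sin x]

theorem abs_sin_le_min {x : ℝ} (hx : 0 ≤ x) : |Real.sin x| ≤ min 1 x :=
  le_min (Real.abs_sin_le_one x) (Real.abs_sin_le_abs.trans_eq (abs_of_nonneg hx))

theorem abs_free_fourier_numerator_le {l x : ℝ} (hl : 0 < l) (hx : 0 ≤ x) :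
    |(1 + l * (l + x)) * Real.sin x - x * Real.cos x|
      ≤ 3 * min 1 x * ((l + x) * (1 + l)) := by
  have hm : 0 ≤ min 1 x := le_min zero_le_one hx
  have hlx : 0 ≤ l * (l + x) := by positivity
  calc |(1 + l * (l + x)) * Real.sin x - x * Real.cos x|
      = |(Real.sin x - x * Real.cos x) + l * (l + x) * Real.sin x| := by ring_nf
    _ ≤ |Real.sin x - x * Real.cos x| + l * (l + x) * |Real.sin x| := by
      refine (abs_add_le _ _).trans_eq ?_
      rw [abs_mul (l * (l + x)), abs_of_nonneg hlx]
    _ ≤ 2 * (min 1 x * x) + l * (l + x) * min 1 x := by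
      gcongr
      · exact abs_sin_sub_mul_cos_le hx
      · exact abs_sin_le_min hx
    _ ≤ 3 * min 1 x * ((l + x) * (1 + l)) := by
      have : 0 ≤ min 1 x * (3 * l + x + 2 * l * (l + x)) := by positivity
      nlinarith

theorem abs_free_fourier_basis_mul_le {r l : ℝ} (hr : 1 ≤ r) (hl : 0 < l) :
    |(l ^ 3 * r)⁻¹ * ((1 + l ^ 2 * r) * Real.sin (l * (r - 1))
        - l * (r - 1) * Real.cos (l * (r - 1)))| * l ^ 2 / (1 + l)
      ≤ 3 * min 1 (l * (r - 1)) := by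
  have hr0 : 0 < r := by linarith
  have h := abs_free_fourier_numerator_le hl (mul_nonneg hl.le (sub_nonneg.2 hr))
  have e : l + l * (r - 1) = l * r := by ring
  have e' : l * (l * r) = l ^ 2 * r := by ring
  rw [e, e'] at h
  rw [abs_mul, abs_of_pos (by positivity : 0 < (l ^ 3 * r)⁻¹)]
  refine le_trans (le_of_eq ?_)
    (div_le_of_le_mul₀ (by positivity : 0 ≤ l * r * (1 + l)) ?_ h)
  · field_simp
  · have := mul_nonneg hl.le (sub_nonneg.2 hr)
    positivity

/-- Uniform bound on the free distorted Fourier basis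
`φ₀(r;λ) = (λ³r)⁻¹[(1+λ²r) sin(λ(r−1)) − λ(r−1) cos(λ(r−1))]`:
`|φ₀(r;λ)| λ²/(1+λ) ≤ C min(1, λ(r−1))`, and in particular
`φ₀(r;λ)² ω₀(λ)` is uniformly bounded, where `ω₀(λ) = 2λ⁴/(1+λ²)`. -/
theorem free_fourier_basis_bound :
    ∃ C > (0:ℝ),
      (∀ r ≥ (1:ℝ), ∀ l : ℝ, 0 < l →
        |(l ^ 3 * r)⁻¹ * ((1 + l ^ 2 * r) * Real.sin (l * (r - 1))
            - l * (r - 1) * Real.cos (l * (r - 1)))| * l ^ 2 / (1 + l)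
          ≤ C * min 1 (l * (r - 1))) ∧
      (∀ r ≥ (1:ℝ), ∀ l : ℝ, 0 < l →
        ((l ^ 3 * r)⁻¹ * ((1 + l ^ 2 * r) * Real.sin (l * (r - 1))
            - l * (r - 1) * Real.cos (l * (r - 1)))) ^ 2 * (2 * l ^ 4 / (1 + l ^ 2))
          ≤ C) := by
  refine ⟨36, by norm_num, fun r hr l hl => ?_, fun r hr l hl => ?_⟩
  · refine (abs_free_fourier_basis_mul_le hr hl).trans ?_
    have hm : 0 ≤ min 1 (l * (r - 1)) :=
      le_min zero_le_one (mul_nonneg hl.le (sub_nonneg.2 hr))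
    linarith
  · have h := (abs_free_fourier_basis_mul_le hr hl).trans
      (mul_le_mul_of_nonneg_left (min_le_left _ _) (by norm_num : (0 : ℝ) ≤ 3))
    generalize (l ^ 3 * r)⁻¹ * ((1 + l ^ 2 * r) * Real.sin (l * (r - 1))
        - l * (r - 1) * Real.cos (l * (r - 1))) = p at h ⊢
    rw [div_le_iff₀ (by positivity)] at h
    have h2 := pow_le_pow_left₀ (by positivity) h 2
    rw [mul_pow, sq_abs] at h2
    rw [← mul_div_assoc, div_le_iff₀ (by positivity)]
    nlinarith [sq_nonneg (l - 1)]
end
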